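/- arXiv:2507.21292 — 3 statements merged into one kernel-verified Lean document; each statement's English description precedes it below -/
import Mathlib

section
/- If n = 4 and W ∈ W(V), then the two conditions W_{αμβν} k^α l^μ k^β h^ν_{ν'} = 0 for all ν' and W_{αμβν} k^α h^μ_{μ'} h^β_{β'} h^ν_{ν'} = 0 for all μ', β', ν' are equivalent; consequently, in four dimensions there is no distinction between algebraic type I_a and algebraic type II. -/
open scoped BigOperators

noncomputable section

namespace Decomp

abbrev Vec (n : ℕ) := Fin n → ℝ
abbrev Ten2 (n : ℕ) := Fin n → Fin n → ℝ
abbrev Ten3 (n : ℕ) := Fin n → Fin n → Fin n → ℝ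
abbrev Ten4 (n : ℕ) := Fin n → Fin n → Fin n → Fin n → ℝ

variable {n : ℕ}

/-- A (0,4)-tensor with the algebraic symmetries of a Riemann tensor. -/
def IsRiemannType (T : Ten4 n) : Prop :=
  (∀ α β μ ν, T α β μ ν = - T α β ν μ) ∧
  (∀ α β μ ν, T α β μ ν = - T β α μ ν) ∧
  (∀ α β μ ν, T α β μ ν = T μ ν α β) ∧
  (∀ α β μ ν, T α β μ ν + T α μ ν β + T α ν β μ = 0)

/-- A (0,3)-tensor antisymmetric in the last two indices with vanishing cyclic sum. -/
def IsLambda12 (F : Ten3 n) : Prop :=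
  (∀ α μ ν, F α μ ν = - F α ν μ) ∧
  (∀ α μ ν, F α μ ν + F μ ν α + F ν α μ = 0)

def IsSym2 (S : Ten2 n) : Prop := ∀ α β, S α β = S β α

/-- Ricci-type trace of a (0,4)-tensor (first and third indices, using the inverse metric). -/
def RicT (ginv : Ten2 n) (T : Ten4 n) : Ten2 n :=
  fun β ν => ∑ α, ∑ μ, ginv α μ * T α β μ ν

/-- Scalar-type trace. -/
def ScalT (ginv : Ten2 n) (T : Ten4 n) : ℝ :=
  ∑ β, ∑ ν, ginv β ν * RicT ginv T β ν

/-- Weyl-type: Riemann-type and trace-free in the first and third indices. -/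
def IsWeylType (ginv : Ten2 n) (T : Ten4 n) : Prop :=
  IsRiemannType T ∧ ∀ β ν, RicT ginv T β ν = 0

/-- Kulkarni–Nomizu product. -/
def KN (A B : Ten2 n) : Ten4 n := fun α β μ ν =>
  A α μ * B β ν - A α ν * B β μ - A β μ * B α ν + A β ν * B α μ

/-- (u ⊛ F) for a one-form w and F ∈ Λ^{(1,2)}. -/
def circ (w : Vec n) (F : Ten3 n) : Ten4 n := fun α β μ ν =>
  w α * F β μ ν - w β * F α μ ν + w μ * F ν α β - w ν * F μ α β

/-- Lower an index with the metric. -/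
def lower (g : Ten2 n) (u : Vec n) : Vec n := fun α => ∑ β, g α β * u β

/-- Projector orthogonal to `u`, both indices covariant: γ_{αβ} = g_{αβ} − ε u_α u_β. -/
def gam (g : Ten2 n) (ε : ℝ) (u : Vec n) : Ten2 n := fun α β =>
  g α β - ε * lower g u α * lower g u β

/-- Mixed projector γ^κ_μ = δ^κ_μ − ε u^κ u_μ. -/
def gamMix (g : Ten2 n) (ε : ℝ) (u : Vec n) : Ten2 n := fun κ μ =>
  (if κ = μ then (1 : ℝ) else 0) - ε * u κ * lower g u μ

/-- Contravariant projector γ^{αβ} = g^{αβ} − ε u^α u^β. -/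
def gamUp (ginv : Ten2 n) (ε : ℝ) (u : Vec n) : Ten2 n := fun α β =>
  ginv α β - ε * u α * u β

/-- η := u⊗u − (ε/(n−3)) γ. -/
def eta (g : Ten2 n) (ε : ℝ) (u : Vec n) : Ten2 n := fun α β =>
  lower g u α * lower g u β - (ε / ((n : ℝ) - 3)) * gam g ε u α β

/-- T^⊥_{βν} := u^α u^μ T_{αβμν}. -/
def perp (u : Vec n) (T : Ten4 n) : Ten2 n := fun β ν =>
  ∑ α, ∑ μ, u α * u μ * T α β μ ν

/-- T^{⊥∥}_{βμν} := u^α γ^κ_μ γ^σ_ν T_{αβκσ}. -/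
def perppar (g : Ten2 n) (ε : ℝ) (u : Vec n) (T : Ten4 n) : Ten3 n := fun β μ ν =>
  ∑ α, ∑ κ, ∑ σ, u α * gamMix g ε u κ μ * gamMix g ε u σ ν * T α β κ σ

/-- T^∥ : projection of T with γ in all four indices. -/
def par4 (g : Ten2 n) (ε : ℝ) (u : Vec n) (T : Ten4 n) : Ten4 n := fun α β μ ν =>
  ∑ ρ, ∑ σ, ∑ κ, ∑ δ,
    gamMix g ε u ρ α * gamMix g ε u σ β * gamMix g ε u κ μ * gamMix g ε u δ ν * T ρ σ κ δ

/-- T^{∥u} := T^∥ + (ε/(n−3)) T^⊥ ∧ γ. -/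
def parU (g : Ten2 n) (ε : ℝ) (u : Vec n) (T : Ten4 n) : Ten4 n := fun α β μ ν =>
  par4 g ε u T α β μ ν + (ε / ((n : ℝ) - 3)) * KN (perp u T) (gam g ε u) α β μ ν

/-- Complete orthogonality to `u` for (0,2)-tensors. -/
def Orth2 (u : Vec n) (S : Ten2 n) : Prop :=
  (∀ β, (∑ α, u α * S α β) = 0) ∧ (∀ β, (∑ α, u α * S β α) = 0)

/-- Complete orthogonality to `u` for (0,3)-tensors. -/
def Orth3 (u : Vec n) (F : Ten3 n) : Prop :=
  (∀ μ ν, (∑ α, u α * F α μ ν) = 0) ∧ (∀ μ ν, (∑ α, u α * F μ α ν) = 0) ∧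
    (∀ μ ν, (∑ α, u α * F μ ν α) = 0)

/-- Complete orthogonality to `u` for (0,4)-tensors. -/
def Orth4 (u : Vec n) (T : Ten4 n) : Prop :=
  (∀ β μ ν, (∑ α, u α * T α β μ ν) = 0) ∧ (∀ β μ ν, (∑ α, u α * T β α μ ν) = 0) ∧
    (∀ β μ ν, (∑ α, u α * T β μ α ν) = 0) ∧ (∀ β μ ν, (∑ α, u α * T β μ ν α) = 0)

/-- tr_γ of a (0,2)-tensor. -/
def trGam (ginv : Ten2 n) (ε : ℝ) (u : Vec n) (S : Ten2 n) : ℝ :=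
  ∑ α, ∑ β, gamUp ginv ε u α β * S α β

/-- Schouten-type tensor of a (0,4)-tensor. -/
def SchT (g ginv : Ten2 n) (T : Ten4 n) : Ten2 n := fun β ν =>
  (1 / ((n : ℝ) - 2)) * (RicT ginv T β ν - ScalT ginv T / (2 * ((n : ℝ) - 1)) * g β ν)

/-- Weyl-type part of a (0,4)-tensor: Weyl(T) := T − Sch(T) ∧ g. -/
def WeylT (g ginv : Ten2 n) (T : Ten4 n) : Ten4 n := fun α β μ ν =>
  T α β μ ν - KN (SchT g ginv T) g α β μ ν

/-- Sch_u for Riemann-type tensors completely orthogonal to u. -/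
def SchU (g ginv : Ten2 n) (ε : ℝ) (u : Vec n) (P : Ten4 n) : Ten2 n := fun β ν =>
  (1 / ((n : ℝ) - 3)) * (RicT ginv P β ν - ScalT ginv P / (2 * ((n : ℝ) - 2)) * gam g ε u β ν)

/-- Weyl_u for Riemann-type tensors completely orthogonal to u. -/
def WeylU (g ginv : Ten2 n) (ε : ℝ) (u : Vec n) (P : Ten4 n) : Ten4 n := fun α β μ ν =>
  P α β μ ν - KN (SchU g ginv ε u P) (gam g ε u) α β μ ν

/-- Z_tr := tr_γ T^⊥. -/
def Ztr (ginv : Ten2 n) (ε : ℝ) (u : Vec n) (T : Ten4 n) : ℝ :=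
  trGam ginv ε u (perp u T)

/-- γ-trace-free part of an orthogonal symmetric (0,2)-tensor. -/
def hat2 (g ginv : Ten2 n) (ε : ℝ) (u : Vec n) (S : Ten2 n) : Ten2 n := fun β ν =>
  S β ν - trGam ginv ε u S / ((n : ℝ) - 1) * gam g ε u β ν

/-- T̂^⊥ := T^⊥ − (Z_tr/(n−1)) γ. -/
def hatPerp (g ginv : Ten2 n) (ε : ℝ) (u : Vec n) (T : Ten4 n) : Ten2 n :=
  hat2 g ginv ε u (perp u T)

/-- (V_tr)_μ := γ^{αβ} T^{⊥∥}_{αβμ}. -/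
def Vtr (g ginv : Ten2 n) (ε : ℝ) (u : Vec n) (T : Ten4 n) : Vec n := fun μ =>
  ∑ α, ∑ β, gamUp ginv ε u α β * perppar g ε u T α β μ

/-- T̂^{⊥∥}_{αβμ} := T^{⊥∥}_{αβμ} + (1/(n−2))(−γ_{αβ}(V_tr)_μ + γ_{αμ}(V_tr)_β). -/
def hatPerppar (g ginv : Ten2 n) (ε : ℝ) (u : Vec n) (T : Ten4 n) : Ten3 n := fun α β μ =>
  perppar g ε u T α β μ + (1 / ((n : ℝ) - 2)) *
    (- gam g ε u α β * Vtr g ginv ε u T μ + gam g ε u α μ * Vtr g ginv ε u T β)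

/-- S^∥_{βν} := γ^ρ_β γ^κ_ν S_{ρκ}. -/
def s2par (g : Ten2 n) (ε : ℝ) (u : Vec n) (S : Ten2 n) : Ten2 n := fun β ν =>
  ∑ ρ, ∑ κ, gamMix g ε u ρ β * gamMix g ε u κ ν * S ρ κ

/-- S^{⊥∥}_β := γ^ρ_β u^κ S_{ρκ}. -/
def s2perppar (g : Ten2 n) (ε : ℝ) (u : Vec n) (S : Ten2 n) : Vec n := fun β =>
  ∑ ρ, ∑ κ, gamMix g ε u ρ β * u κ * S ρ κ

/-- S^⊥ := u^ρ u^κ S_{ρκ}. -/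
def s2perp (u : Vec n) (S : Ten2 n) : ℝ := ∑ ρ, ∑ κ, u ρ * u κ * S ρ κ

/-- σ^{(2)}_{βν} := σ_{βρ} σ^ρ{}_ν. -/
def sq (ginv : Ten2 n) (σ : Ten2 n) : Ten2 n := fun β ν =>
  ∑ ρ, ∑ κ, σ β ρ * ginv ρ κ * σ κ ν

/-- Mixed projector h^μ_{μ'} = γ^μ_{μ'} + ε y^μ y_{μ'} orthogonal to span{u,y}. -/
def hMix (g : Ten2 n) (ε : ℝ) (u y : Vec n) : Ten2 n := fun μ μ' =>
  gamMix g ε u μ μ' + ε * y μ * lower g y μ'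

/-- Covariant projector h_{αβ} = γ_{αβ} + ε y_α y_β. -/
def hCov (g : Ten2 n) (ε : ℝ) (u y : Vec n) : Ten2 n := fun α β =>
  gam g ε u α β + ε * lower g y α * lower g y β

/-- g is a symmetric nondegenerate bilinear form with (symmetric) inverse ginv. -/
def GoodMetric (g ginv : Ten2 n) : Prop :=
  (∀ α β, g α β = g β α) ∧ (∀ α β, ginv α β = ginv β α) ∧
    (∀ α β, (∑ μ, ginv α μ * g μ β) = if α = β then (1 : ℝ) else 0) ∧
    (∀ α β, (∑ μ, g α μ * ginv μ β) = if α = β then (1 : ℝ) else 0)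

/-- u is a unit vector with g(u,u) = ε ∈ {−1,1}. -/
def UnitVec (g : Ten2 n) (ε : ℝ) (u : Vec n) : Prop :=
  (ε = 1 ∨ ε = -1) ∧ (∑ α, ∑ β, g α β * u α * u β) = ε


open scoped Matrix

/-- An idempotent matrix of trace `r` factors through an `r`-dimensional space. -/
lemma exists_factor_of_idempotent {m r : ℕ} (H : Matrix (Fin m) (Fin m) ℝ)
    (hH : H * H = H) (htr : H.trace = r) :
    ∃ (P : Matrix (Fin m) (Fin r) ℝ) (Q : Matrix (Fin r) (Fin m) ℝ), H = P * Q ∧ Q * P = 1 := by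
  set f := Matrix.toLin' H with hf
  have hid : IsIdempotentElem f := by
    change f ∘ₗ f = f
    rw [hf, ← Matrix.toLin'_mul, hH]
  have hproj := LinearMap.IsIdempotentElem.isProj_range f hid
  have hrank : Module.finrank ℝ (LinearMap.range f) = r := by
    have h1 := hproj.trace
    rw [hf, Matrix.trace_toLin'_eq, htr] at h1
    exact_mod_cast h1.symm
  let b := Module.finBasisOfFinrankEq ℝ (LinearMap.range f) hrank
  let p : (Fin r → ℝ) →ₗ[ℝ] (Fin m → ℝ) :=
    (LinearMap.range f).subtype ∘ₗ b.equivFun.symm.toLinearMap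
  let q : (Fin m → ℝ) →ₗ[ℝ] (Fin r → ℝ) := b.equivFun.toLinearMap ∘ₗ f.rangeRestrict
  have hpq : p ∘ₗ q = f := by
    refine LinearMap.ext fun x => ?_
    simp [p, q]
  have hqp : q ∘ₗ p = LinearMap.id := by
    apply LinearMap.ext
    intro x
    have hx : f.rangeRestrict (b.equivFun.symm x : LinearMap.range f) = b.equivFun.symm x :=
      Subtype.ext (hproj.map_id _ (b.equivFun.symm x).2)
    change b.equivFun (f.rangeRestrict (b.equivFun.symm x : LinearMap.range f)) = x
    rw [hx, LinearEquiv.apply_symm_apply]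
  refine ⟨LinearMap.toMatrix' p, LinearMap.toMatrix' q, ?_, ?_⟩
  · rw [← LinearMap.toMatrix'_comp, hpq, hf, LinearMap.toMatrix'_toLin']
  · rw [← LinearMap.toMatrix'_comp, hqp, LinearMap.toMatrix'_id]

/-- On a two-dimensional space, a tensor antisymmetric in its last two slots is determined by its
trace over the first two slots with respect to an invertible matrix. -/
lemma trace_eq_zero_iff_of_antisymm {h m : Matrix (Fin 2) (Fin 2) ℝ} (hm : h * m = 1) (G : Ten3 2)
    (hG : ∀ i j k, G i j k = - G i k j) :
    (∀ k, (∑ i, ∑ j, h i j * G i j k) = 0) ↔ ∀ i j k, G i j k = 0 := by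
  refine ⟨fun H => ?_, fun H k => by simp [H]⟩
  have diag : ∀ i j, G i j j = 0 := fun i j => by linarith [hG i j j]
  have key : (fun i => G i 0 1) ᵥ* h = 0 := by
    ext j
    have h0 := H 0
    have h1 := H 1
    simp only [Fin.sum_univ_two, diag, hG _ 1 0] at h0 h1
    fin_cases j <;> simp [Matrix.vecMul, dotProduct, Fin.sum_univ_two] <;> linarith
  have zero : (fun i => G i 0 1) = 0 := by
    rw [← Matrix.vecMul_one (fun i => G i 0 1), ← hm, ← Matrix.vecMul_vecMul, key,
      Matrix.zero_vecMul]
  have z : ∀ i, G i 0 1 = 0 := fun i => congrFun zero i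
  intro i j k
  fin_cases j <;> fin_cases k <;> simp [diag, z, hG i 1 0]

lemma contract_eq_zero_iff {m r : ℕ} {H : Matrix (Fin m) (Fin m) ℝ}
    {P : Matrix (Fin m) (Fin r) ℝ} {Q : Matrix (Fin r) (Fin m) ℝ}
    (hPQ : H = P * Q) (hQP : Q * P = 1) (f : Fin m → ℝ) :
    (∀ i', (∑ i, H i i' * f i) = 0) ↔ ∀ j, (∑ i, P i j * f i) = 0 := by
  have e1 : (∀ i', (∑ i, H i i' * f i) = 0) ↔ f ᵥ* H = 0 := by
    simp [funext_iff, Matrix.vecMul, dotProduct, mul_comm]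
  have e2 : (∀ j, (∑ i, P i j * f i) = 0) ↔ f ᵥ* P = 0 := by
    simp [funext_iff, Matrix.vecMul, dotProduct, mul_comm]
  rw [e1, e2]
  constructor
  · intro h
    have : H * P = P := by rw [hPQ, Matrix.mul_assoc, hQP, Matrix.mul_one]
    rw [← this, ← Matrix.vecMul_vecMul, h, Matrix.zero_vecMul]
  · intro h
    rw [hPQ, ← Matrix.vecMul_vecMul, h, Matrix.zero_vecMul]

lemma sum_mul_sum_comm {m r : ℕ} (a : Fin m → ℝ) (b : Fin r → ℝ) (f : Fin m → Fin r → ℝ) :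
    (∑ i, a i * ∑ j, b j * f i j) = ∑ j, b j * ∑ i, a i * f i j := by
  simp only [Finset.mul_sum]
  rw [Finset.sum_comm]
  exact Finset.sum_congr rfl fun _ _ => Finset.sum_congr rfl fun _ _ => mul_left_comm _ _ _

lemma contract_three_eq_zero_iff {m r : ℕ} {H : Matrix (Fin m) (Fin m) ℝ}
    {P : Matrix (Fin m) (Fin r) ℝ} {Q : Matrix (Fin r) (Fin m) ℝ}
    (hPQ : H = P * Q) (hQP : Q * P = 1) (F : Ten3 m) :
    (∀ i' j' k', (∑ i, H i i' * ∑ j, H j j' * ∑ k, H k k' * F i j k) = 0) ↔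
      ∀ a b c, (∑ i, P i a * ∑ j, P j b * ∑ k, P k c * F i j k) = 0 := by
  have one := fun f => contract_eq_zero_iff hPQ hQP f
  have swap : ∀ (A B C : Fin m → ℝ), (∑ i, A i * ∑ j, B j * ∑ k, C k * F i j k) =
      ∑ k, C k * ∑ i, A i * ∑ j, B j * F i j k := fun A B C => by
    simp only [fun i => sum_mul_sum_comm B C (F i)]
    exact sum_mul_sum_comm A C _
  calc _ ↔ ∀ j' k' a, (∑ i, P i a * ∑ j, H j j' * ∑ k, H k k' * F i j k) = 0 :=
        ⟨fun h j' k' => (one _).1 fun i' => h i' j' k', fun h i' j' k' => (one _).2 (h j' k') i'⟩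
    _ ↔ ∀ k' a b, (∑ i, P i a * ∑ j, P j b * ∑ k, H k k' * F i j k) = 0 := by
        simp only [fun (a : Fin r) (B : Fin m → ℝ) (k' : Fin m) =>
          sum_mul_sum_comm (fun i => P i a) B fun i j => ∑ k, H k k' * F i j k]
        exact ⟨fun h k' a => (one _).1 fun j' => h j' k' a,
          fun h j' k' a => (one _).2 (h k' a) j'⟩
    _ ↔ _ := by
        simp only [fun (a b : Fin r) => swap (fun i => P i a) (fun j => P j b)]
        exact ⟨fun h a b => (one _).1 fun k' => h k' a b, fun h k' a b => (one _).2 (h a b) k'⟩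

/-- The projector orthogonal to `u` and `y` in matrix form. -/
lemma hMix_eq {n : ℕ} (g : Ten2 n) (ε : ℝ) (u y : Vec n) :
    Matrix.of (hMix g ε u y) =
      1 - ε • Matrix.vecMulVec u (lower g u) + ε • Matrix.vecMulVec y (lower g y) := by
  ext i j
  simp [hMix, gamMix, Matrix.vecMulVec_apply, Matrix.one_apply]
  ring

/-- The projector orthogonal to `u` and `y` factors through a two-dimensional space on which the
contravariant projector is nondegenerate. -/
lemma exists_orthogonal_frame {g ginv : Ten2 4} (hg : GoodMetric g ginv)
    {ε : ℝ} {u y : Vec 4} (hu : UnitVec g ε u)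
    (hyu : (∑ α, ∑ β, g α β * u α * y β) = 0) (hy : (∑ α, ∑ β, g α β * y α * y β) = -ε) :
    ∃ (P : Matrix (Fin 4) (Fin 2) ℝ) (Q : Matrix (Fin 2) (Fin 4) ℝ)
      (h m : Matrix (Fin 2) (Fin 2) ℝ),
      hMix g ε u y = P * Q ∧ Q * P = 1 ∧ h * m = 1 ∧
      P * h * P.transpose = (Matrix.of ginv) - ε • Matrix.vecMulVec u u
        + ε • Matrix.vecMulVec y y := by
  obtain ⟨gs, gis, gig, -⟩ := hg
  obtain ⟨hε, huu⟩ := hu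
  have hε2 : ε * ε = 1 := by rcases hε with rfl | rfl <;> norm_num
  set G : Matrix (Fin 4) (Fin 4) ℝ := Matrix.of g with hG
  set Gi : Matrix (Fin 4) (Fin 4) ℝ := Matrix.of ginv
  have Gt : G.transpose = G := by ext i j; exact gs j i
  have Git : Gi.transpose = Gi := by ext i j; exact gis j i
  have GiG : Gi * G = 1 := by
    ext i j
    rw [Matrix.mul_apply, Matrix.one_apply]
    exact gig i j
  have form : ∀ a b : Vec 4, a ⬝ᵥ (G *ᵥ b) = ∑ α, ∑ β, g α β * a α * b β := fun a b => by
    simp only [dotProduct, Matrix.mulVec, Finset.mul_sum]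
    exact Finset.sum_congr rfl fun _ _ => Finset.sum_congr rfl fun _ _ => by simp [hG]; ring
  have fsymm : ∀ a b : Vec 4, a ⬝ᵥ (G *ᵥ b) = b ⬝ᵥ (G *ᵥ a) := fun a b => by
    rw [Matrix.dotProduct_mulVec, ← Matrix.mulVec_transpose, Gt, dotProduct_comm]
  have duu : (G *ᵥ u) ⬝ᵥ u = ε := by rw [dotProduct_comm, form, huu]
  have dyy : (G *ᵥ y) ⬝ᵥ y = -ε := by rw [dotProduct_comm, form, hy]
  have dyu : (G *ᵥ y) ⬝ᵥ u = 0 := by rw [dotProduct_comm, form, hyu]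
  have duy : (G *ᵥ u) ⬝ᵥ y = 0 := by rw [dotProduct_comm, fsymm, form, hyu]
  have GiGv : ∀ v, Gi *ᵥ (G *ᵥ v) = v := fun v => by
    rw [Matrix.mulVec_mulVec, GiG, Matrix.one_mulVec]
  have GvGi : ∀ v, (G *ᵥ v) ᵥ* Gi = v := fun v => by
    rw [← Matrix.mulVec_transpose, Git, GiGv]
  have vG : ∀ v, v ᵥ* G = G *ᵥ v := fun v => by rw [← Matrix.mulVec_transpose, Gt]
  set H : Matrix (Fin 4) (Fin 4) ℝ := hMix g ε u y
  have hH : H = 1 - ε • Matrix.vecMulVec u (G *ᵥ u) + ε • Matrix.vecMulVec y (G *ᵥ y) :=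
    hMix_eq g ε u y
  have idem : H * H = H := by
    rw [hH]
    simp only [add_mul, mul_add, sub_mul, mul_sub, one_mul, mul_one, Matrix.smul_mul,
      Matrix.mul_smul, Matrix.vecMulVec_mul_vecMulVec, duu, dyy, dyu, duy, smul_smul, hε2,
      zero_smul, Matrix.vecMulVec_smul, Matrix.vecMulVec_zero, smul_zero, one_smul, neg_smul,
      Matrix.vecMulVec_neg, smul_neg]
    module
  have tr : H.trace = (2 : ℕ) := by
    rw [hH]
    simp only [Matrix.trace_add, Matrix.trace_sub, Matrix.trace_smul, Matrix.trace_one,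
      Matrix.trace_vecMulVec, dotProduct_comm _ (G *ᵥ _), duu, dyy, smul_eq_mul, mul_neg, hε2]
    norm_num
  obtain ⟨P, Q, hPQ, hQP⟩ := exists_factor_of_idempotent H idem tr
  have hK : H * Gi = Gi - ε • Matrix.vecMulVec u u + ε • Matrix.vecMulVec y y := by
    rw [hH]
    simp only [add_mul, sub_mul, one_mul, Matrix.smul_mul, Matrix.vecMulVec_mul, GvGi]
  have hKt : Gi * H.transpose = H * Gi := by
    rw [← Matrix.transpose_transpose (Gi * H.transpose), Matrix.transpose_mul,
      Matrix.transpose_transpose, Git, hK]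
    simp [Matrix.transpose_vecMulVec, Git]
  have hGH : H.transpose * G = G * H := by
    rw [hH]
    simp only [Matrix.transpose_add, Matrix.transpose_sub, Matrix.transpose_smul,
      Matrix.transpose_one, Matrix.transpose_vecMulVec, add_mul, mul_add, sub_mul, mul_sub,
      one_mul, mul_one, Matrix.smul_mul, Matrix.mul_smul, Matrix.vecMulVec_mul,
      Matrix.mul_vecMulVec, vG]
  refine ⟨P, Q, Q * Gi * Q.transpose, P.transpose * G * P, hPQ, hQP, ?_, ?_⟩
  · calc Q * Gi * Q.transpose * (P.transpose * G * P)
        = Q * Gi * ((P * Q).transpose * G) * P := by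
          simp only [Matrix.transpose_mul, Matrix.mul_assoc]
      _ = Q * (Gi * G) * H * P := by rw [← hPQ, hGH]; simp only [Matrix.mul_assoc]
      _ = (Q * P) * (Q * P) := by rw [GiG, hPQ]; simp only [Matrix.mul_assoc, Matrix.one_mul]
      _ = 1 := by rw [hQP, one_mul]
  · calc P * (Q * Gi * Q.transpose) * P.transpose
        = H * (Gi * H.transpose) := by
          rw [hPQ]; simp only [Matrix.transpose_mul, Matrix.mul_assoc]
      _ = H * Gi := by rw [hKt, ← Matrix.mul_assoc, idem]
      _ = _ := hK

/-- Contraction of the first three slots of a tensor with vectors. -/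
def contract3 {n : ℕ} (W : Ten4 n) (a b c : Vec n) : Vec n := fun ν =>
  ∑ α, ∑ μ, ∑ β, a α * b μ * c β * W α μ β ν

lemma contract3_swap {n : ℕ} {W : Ten4 n} (hW : ∀ α β μ ν, W α β μ ν = - W β α μ ν)
    (a b c : Vec n) (ν : Fin n) : contract3 W a b c ν = - contract3 W b a c ν := by
  unfold contract3
  rw [Finset.sum_comm]
  simp only [← Finset.sum_neg_distrib]
  refine Finset.sum_congr rfl fun μ _ => Finset.sum_congr rfl fun α _ =>
    Finset.sum_congr rfl fun β _ => ?_
  rw [hW α μ]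
  ring

lemma contract3_self {n : ℕ} {W : Ten4 n} (hW : ∀ α β μ ν, W α β μ ν = - W β α μ ν)
    (a c : Vec n) (ν : Fin n) : contract3 W a a c ν = 0 := by
  linarith [contract3_swap hW a a c ν]

/-- The `k`-`l`-`k` component of a Weyl-type tensor as a trace over the space orthogonal to
`u` and `y`. -/
lemma contract3_null_eq_trace {n : ℕ} {ginv : Ten2 n} {W : Ten4 n} (hW : IsWeylType ginv W)
    (ε s : ℝ) (hs : s ≠ 0) (u y : Vec n) (ν : Fin n) :
    contract3 W (fun α => s * (u α + y α)) (fun μ => -(ε / 2) * s⁻¹ * (u μ - y μ))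
        (fun β => s * (u β + y β)) ν =
      ∑ μ, ∑ β, (ginv μ β - ε * (u μ * u β) + ε * (y μ * y β)) *
        ∑ α, s * (u α + y α) * W α μ β ν := by
  have anti := hW.1.2.1
  have trz : (∑ μ, ∑ β, ginv μ β * ∑ α, s * (u α + y α) * W α μ β ν) = 0 := by
    calc _ = -∑ α, s * (u α + y α) * RicT ginv W α ν := by
          simp only [RicT, Finset.mul_sum, ← Finset.sum_neg_distrib]
          rw [Finset.sum_comm_cycle]
          refine Finset.sum_congr rfl fun α _ => Finset.sum_congr rfl fun μ _ =>
            Finset.sum_congr rfl fun β _ => ?_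
          rw [anti α μ]
          ring
      _ = 0 := by simp [hW.2]
  have outer : ∀ v : Vec n, (∑ μ, ∑ β, ε * (v μ * v β) * ∑ α, s * (u α + y α) * W α μ β ν) =
      ε * s * (contract3 W u v v ν + contract3 W y v v ν) := fun v => by
    simp only [contract3, Finset.mul_sum, ← Finset.sum_add_distrib]
    rw [Finset.sum_comm_cycle]
    exact Finset.sum_congr rfl fun α _ => Finset.sum_congr rfl fun μ _ =>
      Finset.sum_congr rfl fun β _ => by ring
  have lhs : contract3 W (fun α => s * (u α + y α)) (fun μ => -(ε / 2) * s⁻¹ * (u μ - y μ))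
        (fun β => s * (u β + y β)) ν = -(ε / 2) * s *
      (contract3 W u u u ν + contract3 W u u y ν - contract3 W u y u ν - contract3 W u y y ν +
        contract3 W y u u ν + contract3 W y u y ν - contract3 W y y u ν - contract3 W y y y ν) := by
    simp only [contract3, Finset.mul_sum, ← Finset.sum_add_distrib, ← Finset.sum_sub_distrib]
    refine Finset.sum_congr rfl fun α _ => Finset.sum_congr rfl fun μ _ =>
      Finset.sum_congr rfl fun β _ => ?_
    field_simp
    ring
  have rhs : (∑ μ, ∑ β, (ginv μ β - ε * (u μ * u β) + ε * (y μ * y β)) *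
        ∑ α, s * (u α + y α) * W α μ β ν) =
      0 - ε * s * (contract3 W u u u ν + contract3 W y u u ν) +
        ε * s * (contract3 W u y y ν + contract3 W y y y ν) := by
    rw [← outer u, ← outer y, ← trz]
    simp only [← Finset.sum_add_distrib, ← Finset.sum_sub_distrib, add_mul, sub_mul]
  rw [lhs, rhs]
  simp only [contract3_self anti, contract3_swap anti y u]
  ring

/-- in four dimensions, for a Weyl-type tensor, the type `I_a` condition and
the multiple-WAND (type `II`) condition are equivalent. -/
theorem stmt17 {n : ℕ} (hn4 : n = 4) (g ginv : Ten2 n) (hg : GoodMetric g ginv)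
    (ε : ℝ) (u : Vec n) (hu : UnitVec g ε u)
    (y : Vec n) (hyu : (∑ α, ∑ β, g α β * u α * y β) = 0)
    (hy : (∑ α, ∑ β, g α β * y α * y β) = -ε)
    (s : ℝ) (hs : s ≠ 0)
    (W : Ten4 n) (hW : IsWeylType ginv W) :
    (∀ ν',
        (∑ α, ∑ μ, ∑ β, ∑ ν, (s * (u α + y α)) * (-(ε / 2) * s⁻¹ * (u μ - y μ)) *
          (s * (u β + y β)) * hMix g ε u y ν ν' * W α μ β ν) = 0) ↔
      (∀ μ' β' ν',
        (∑ α, ∑ μ, ∑ β, ∑ ν, (s * (u α + y α)) * hMix g ε u y μ μ' *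
          hMix g ε u y β β' * hMix g ε u y ν ν' * W α μ β ν) = 0) := by
  subst hn4
  obtain ⟨P, Q, h, m, hPQ, hQP, hm, hK⟩ := exists_orthogonal_frame hg hu hyu hy
  set F : Ten3 4 := fun μ β ν => ∑ α, s * (u α + y α) * W α μ β ν with hF
  set X := contract3 W (fun α => s * (u α + y α)) (fun μ => -(ε / 2) * s⁻¹ * (u μ - y μ))
    (fun β => s * (u β + y β)) with hX
  let G : Ten3 2 := fun a b c => ∑ i, P i a * ∑ j, P j b * ∑ k, P k c * F i j k
  have lhs : ∀ ν', (∑ α, ∑ μ, ∑ β, ∑ ν, (s * (u α + y α)) * (-(ε / 2) * s⁻¹ * (u μ - y μ)) *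
      (s * (u β + y β)) * hMix g ε u y ν ν' * W α μ β ν) = ∑ ν, hMix g ε u y ν ν' * X ν := by
    intro ν'
    simp only [hX, contract3, Finset.mul_sum]
    symm
    refine Finset.sum_comm.trans (Finset.sum_congr rfl fun α _ => ?_)
    refine Finset.sum_comm.trans (Finset.sum_congr rfl fun μ _ => ?_)
    refine Finset.sum_comm.trans (Finset.sum_congr rfl fun β _ => ?_)
    exact Finset.sum_congr rfl fun ν _ => by ring
  have rhs : ∀ μ' β' ν', (∑ α, ∑ μ, ∑ β, ∑ ν, (s * (u α + y α)) * hMix g ε u y μ μ' *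
      hMix g ε u y β β' * hMix g ε u y ν ν' * W α μ β ν) =
      ∑ μ, hMix g ε u y μ μ' * ∑ β, hMix g ε u y β β' * ∑ ν, hMix g ε u y ν ν' * F μ β ν := by
    intro μ' β' ν'
    simp only [hF, Finset.mul_sum]
    rw [Finset.sum_comm]
    refine Finset.sum_congr rfl fun μ _ => ?_
    rw [Finset.sum_comm]
    refine Finset.sum_congr rfl fun β _ => ?_
    rw [Finset.sum_comm]
    exact Finset.sum_congr rfl fun ν _ => Finset.sum_congr rfl fun α _ => by ring
  have hXF : ∀ ν, X ν = ∑ i, ∑ j, h i j * ∑ μ, P μ i * ∑ β, P β j * F μ β ν := by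
    intro ν
    have hKe : ∀ μ β, ginv μ β - ε * (u μ * u β) + ε * (y μ * y β) =
        ∑ i, ∑ j, P μ i * h i j * P β j := fun μ β => by
      have := congrFun (congrFun hK μ) β
      simp only [Matrix.add_apply, Matrix.sub_apply, Matrix.smul_apply, Matrix.of_apply,
        Matrix.vecMulVec_apply, smul_eq_mul] at this
      rw [← this]
      simp only [Matrix.mul_apply, Matrix.transpose_apply, Finset.sum_mul]
      rw [Finset.sum_comm]
    rw [hX, contract3_null_eq_trace hW ε s hs u y ν]
    simp only [hKe, Fin.sum_univ_two, Finset.mul_sum, ← Finset.sum_add_distrib]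
    refine Finset.sum_congr rfl fun μ _ => Finset.sum_congr rfl fun β _ => ?_
    simp only [← Finset.mul_sum]
    simp only [hF]
    ring
  have hXG : ∀ c, (∑ ν, P ν c * X ν) = ∑ i, ∑ j, h i j * G i j c := by
    intro c
    have swap : ∀ a b, G a b c = ∑ k, P k c * ∑ i, P i a * ∑ j, P j b * F i j k := fun a b => by
      simp only [G, fun i => sum_mul_sum_comm (fun j => P j b) (fun k => P k c) (F i)]
      exact sum_mul_sum_comm _ _ _
    simp only [swap, hXF]
    simp only [Fin.sum_univ_two, mul_add, Finset.sum_add_distrib,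
      Finset.mul_sum (s := Finset.univ (α := Fin 4)), mul_left_comm]
  have hG : ∀ a b c, G a b c = - G a c b := by
    intro a b c
    simp only [G, ← Finset.sum_neg_distrib, ← mul_neg]
    refine Finset.sum_congr rfl fun i _ => ?_
    rw [sum_mul_sum_comm]
    congr 1
    refine Finset.sum_congr rfl fun k _ => ?_
    congr 1
    refine Finset.sum_congr rfl fun j _ => ?_
    simp only [hF, ← Finset.sum_neg_distrib]
    congr 1
    exact Finset.sum_congr rfl fun α _ => by rw [hW.1.1 α i j k]; ring
  simp only [lhs, rhs]
  rw [contract_eq_zero_iff hPQ hQP, contract_three_eq_zero_iff hPQ hQP,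
    ← trace_eq_zero_iff_of_antisymm hm G hG]
  simp only [hXG]

end Decomp
end
end

section
/- Suppose n = 4 and W ∈ W(V) satisfies the two conditions 2 W^⊥_{μν} h^μ_{μ'} h^ν_{ν'} + 2 W^{⊥∥}_{(μ|α|ν)} y^α h^μ_{μ'} h^ν_{ν'} − ε W^⊥_{αβ} y^α y^β h_{μ'ν'} = 0 and W^⊥_{μν} y^μ h^ν_{ν'} + W^{⊥∥}_{αβν} y^α y^β h^ν_{ν'} = 0, where W^{⊥∥}_{(μ|α|ν)} := (1/2)(W^{⊥∥}_{μαν} + W^{⊥∥}_{ναμ}). Then W^⊥ is completely determined by its components along y: W^⊥_{μ'ν'} = (3/2) W^⊥_{αβ} y^α y^β (y_{μ'} y_{ν'} + (ε/3) γ_{μ'ν'}) + 2ε W^{⊥∥}_{αβν} y^α y^β y_{(μ'} h^ν_{ν')} − W^{⊥∥}_{(μ|α|ν)} y^α h^μ_{μ'} h^ν_{ν'}. -/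
open scoped BigOperators

noncomputable section

namespace Decomp

variable {n : ℕ}

/-- Contracting a covector that annihilates `u` with the projector `h`. -/
lemma sum_mul_hMix (g : Ten2 n) (ε : ℝ) (u y a : Vec n)
    (ha : ∑ μ, a μ * u μ = 0) (μ' : Fin n) :
    ∑ μ, a μ * hMix g ε u y μ μ' = a μ' + ε * (∑ μ, a μ * y μ) * lower g y μ' := by
  have h : ∀ μ, a μ * hMix g ε u y μ μ' = a μ * (if μ = μ' then (1 : ℝ) else 0)
      - ε * lower g u μ' * (a μ * u μ) + ε * lower g y μ' * (a μ * y μ) := by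
    intro μ
    simp only [hMix, gamMix]
    ring
  rw [Finset.sum_congr rfl fun μ _ => h μ, Finset.sum_add_distrib, Finset.sum_sub_distrib,
    ← Finset.mul_sum, ← Finset.mul_sum, ha]
  simp only [mul_ite, mul_one, mul_zero, Finset.sum_ite_eq',
    Finset.mem_univ, if_true]
  ring

lemma perp_symm (u : Vec n) {T : Ten4 n} (hT : IsRiemannType T) : IsSym2 (perp u T) := by
  intro β ν
  unfold perp
  rw [Finset.sum_comm]
  refine Finset.sum_congr rfl fun μ _ => Finset.sum_congr rfl fun α _ => ?_
  rw [hT.2.2.1 α β μ ν]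
  ring

lemma sum_perp_mul_self (u : Vec n) {T : Ten4 n} (hT : IsRiemannType T) (β : Fin n) :
    ∑ ν, perp u T β ν * u ν = 0 := by
  have h : ∀ α, ∑ μ, ∑ ν, u μ * u ν * T α β μ ν = 0 := by
    intro α
    have h' : ∑ μ, ∑ ν, u μ * u ν * T α β μ ν = -∑ μ, ∑ ν, u μ * u ν * T α β μ ν := by
      conv_lhs => rw [Finset.sum_comm]
      simp only [← Finset.sum_neg_distrib]
      refine Finset.sum_congr rfl fun μ _ => Finset.sum_congr rfl fun ν _ => ?_
      rw [hT.1 α β ν μ]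
      ring
    linarith
  calc ∑ ν, perp u T β ν * u ν
      = ∑ α, u α * ∑ μ, ∑ ν, u μ * u ν * T α β μ ν := by
        simp only [perp, Finset.sum_mul, Finset.mul_sum]
        rw [Finset.sum_comm]
        refine Finset.sum_congr rfl fun α _ => ?_
        rw [Finset.sum_comm]
        refine Finset.sum_congr rfl fun μ _ => Finset.sum_congr rfl fun ν _ => ?_
        ring
    _ = 0 := by simp only [h, mul_zero, Finset.sum_const_zero]

/-- The `y`-`h` block of a symmetric tensor annihilating `u`. -/
lemma sum_mul_mul_hMix (g : Ten2 n) (ε : ℝ) (u y : Vec n) {P : Ten2 n} (hP : IsSym2 P)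
    (hPu : ∀ β, ∑ ν, P β ν * u ν = 0) (ν' : Fin n) :
    ∑ μ, ∑ ν, P μ ν * y μ * hMix g ε u y ν ν' =
      (∑ μ, P ν' μ * y μ) + ε * (∑ α, ∑ β, P α β * y α * y β) * lower g y ν' := by
  have h : ∀ μ, ∑ ν, P μ ν * y μ * hMix g ε u y ν ν' =
      P ν' μ * y μ + ε * lower g y ν' * ∑ ν, P μ ν * y μ * y ν := by
    intro μ
    have hμ : ∑ ν, P μ ν * y μ * u ν = 0 := by
      rw [Finset.sum_congr rfl fun ν _ => mul_right_comm (P μ ν) (y μ) (u ν), ← Finset.sum_mul,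
        hPu, zero_mul]
    rw [sum_mul_hMix g ε u y (fun ν => P μ ν * y μ) hμ, hP μ ν']
    ring
  rw [Finset.sum_congr rfl fun μ _ => h μ, Finset.sum_add_distrib, ← Finset.mul_sum]
  ring

/-- The `h`-`h` block of a symmetric tensor annihilating `u`. -/
lemma sum_mul_hMix_mul_hMix (g : Ten2 n) (ε : ℝ) (u y : Vec n) {P : Ten2 n}
    (hP : IsSym2 P) (hPu : ∀ β, ∑ ν, P β ν * u ν = 0) (μ' ν' : Fin n) :
    ∑ μ, ∑ ν, P μ ν * hMix g ε u y μ μ' * hMix g ε u y ν ν' =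
      P μ' ν' + ε * (∑ μ, P ν' μ * y μ) * lower g y μ' + ε * (∑ μ, P μ' μ * y μ) * lower g y ν'
        + ε ^ 2 * (∑ α, ∑ β, P α β * y α * y β) * lower g y μ' * lower g y ν' := by
  have h : ∀ μ, ∑ ν, P μ ν * hMix g ε u y μ μ' * hMix g ε u y ν ν' =
      P ν' μ * hMix g ε u y μ μ'
        + ε * lower g y ν' * ∑ ν, P ν μ * y ν * hMix g ε u y μ μ' := by
    intro μ
    have hμ : ∀ ν, P μ ν * hMix g ε u y μ μ' * hMix g ε u y ν ν' =
        hMix g ε u y μ μ' * (P μ ν * hMix g ε u y ν ν') := fun ν => by ring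
    rw [Finset.sum_congr rfl fun ν _ => hμ ν, ← Finset.mul_sum,
      sum_mul_hMix g ε u y (P μ) (hPu μ), ← Finset.sum_mul,
      Finset.sum_congr rfl fun ν _ => congrArg (· * y ν) (hP ν μ), hP μ ν']
    ring
  rw [Finset.sum_congr rfl fun μ _ => h μ, Finset.sum_add_distrib, ← Finset.mul_sum,
    sum_mul_hMix g ε u y (P ν') (hPu ν'), Finset.sum_comm,
    sum_mul_mul_hMix g ε u y hP hPu, hP ν' μ']
  ring

/-- equation `WpertypeII`: in four dimensions, for a Weyl-type tensor
satisfying the type conditions, `W^⊥` is determined by its components along `y`. -/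
theorem stmt18 {n : ℕ} (hn4 : n = 4) (g ginv : Ten2 n) (hg : GoodMetric g ginv)
    (ε : ℝ) (u : Vec n) (hu : UnitVec g ε u)
    (y : Vec n) (hyu : (∑ α, ∑ β, g α β * u α * y β) = 0)
    (hy : (∑ α, ∑ β, g α β * y α * y β) = -ε)
    (W : Ten4 n) (hW : IsWeylType ginv W)
    (h1 : ∀ μ' ν',
      2 * (∑ μ, ∑ ν, perp u W μ ν * hMix g ε u y μ μ' * hMix g ε u y ν ν')
      + 2 * (∑ μ, ∑ α, ∑ ν, ((perppar g ε u W μ α ν + perppar g ε u W ν α μ) / 2) *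
          y α * hMix g ε u y μ μ' * hMix g ε u y ν ν')
      - ε * (∑ α, ∑ β, perp u W α β * y α * y β) * hCov g ε u y μ' ν' = 0)
    (h2 : ∀ ν',
      (∑ μ, ∑ ν, perp u W μ ν * y μ * hMix g ε u y ν ν')
      + (∑ α, ∑ β, ∑ ν, perppar g ε u W α β ν * y α * y β * hMix g ε u y ν ν') = 0) :
    ∀ μ' ν', perp u W μ' ν' =
      (3 / 2) * (∑ α, ∑ β, perp u W α β * y α * y β) *
        (lower g y μ' * lower g y ν' + (ε / 3) * gam g ε u μ' ν')
      + 2 * ε * ((1 / 2) *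
          (lower g y μ' *
              (∑ α, ∑ β, ∑ ν, perppar g ε u W α β ν * y α * y β * hMix g ε u y ν ν')
            + lower g y ν' *
              (∑ α, ∑ β, ∑ ν, perppar g ε u W α β ν * y α * y β * hMix g ε u y ν μ')))
      - (∑ μ, ∑ α, ∑ ν, ((perppar g ε u W μ α ν + perppar g ε u W ν α μ) / 2) *
          y α * hMix g ε u y μ μ' * hMix g ε u y ν ν') := by
  intro μ' ν'
  have hε : ε ^ 2 = 1 := by rcases hu.1 with h | h <;> rw [h] <;> norm_num
  have hP := perp_symm u hW.1
  have hPu := sum_perp_mul_self u hW.1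
  have e1 := h1 μ' ν'
  have e2 := h2 μ'
  have e3 := h2 ν'
  rw [sum_mul_hMix_mul_hMix g ε u y hP hPu] at e1
  rw [sum_mul_mul_hMix g ε u y hP hPu] at e2 e3
  simp only [hCov] at e1
  generalize (∑ α, ∑ β, perp u W α β * y α * y β) = p at *
  linear_combination (1 / 2) * e1 - ε * lower g y ν' * e2 - ε * lower g y μ' * e3
    + (3 / 2) * p * lower g y μ' * lower g y ν' * hε


end Decomp
end
end

section
/- With N_{μν} := φ_μ y_ν + f P_{μν} (the pointwise algebraic model of D_μ ξ_ν for ξ = f y, with φ modelling Df and P modelling Dy), the equation 2 N_{(μν)} − (2/3)(γ^{αβ} N_{αβ}) γ_{μν} = 0 holds if and only if the following three conditions hold: h^ν_{ν'} φ_ν − ε f b_{ν'} = 0, y^α φ_α − (f ℓ)/2 = 0, and Π = 0. In other words, the conformal Killing equation for ξ = f y in dimension three is equivalent to this system of equations. -/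
open scoped BigOperators

noncomputable section

namespace CKV

/-- Lowered index: y_α = γ_{αβ} y^β. -/
def yl (γ : Fin 3 → Fin 3 → ℝ) (y : Fin 3 → ℝ) : Fin 3 → ℝ := fun α => ∑ β, γ α β * y β

/-- Covariant projector orthogonal to y: h_{αβ} = γ_{αβ} + ε y_α y_β. -/
def hcov (γ : Fin 3 → Fin 3 → ℝ) (ε : ℝ) (y : Fin 3 → ℝ) : Fin 3 → Fin 3 → ℝ :=
  fun α β => γ α β + ε * yl γ y α * yl γ y β

/-- Mixed projector h^ν_{ν'} = γ^{νρ} h_{ρν'}. -/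
def hmix (γ γinv : Fin 3 → Fin 3 → ℝ) (ε : ℝ) (y : Fin 3 → ℝ) : Fin 3 → Fin 3 → ℝ :=
  fun ν ν' => ∑ ρ, γinv ν ρ * hcov γ ε y ρ ν'

/-- The decomposed model of D_μ y_ν:
P_{αβ} = −ε y_α b_β + Π_{αβ} + (ℓ/2) h_{αβ} + w_{αβ}. -/
def P (γ : Fin 3 → Fin 3 → ℝ) (ε : ℝ) (y b : Fin 3 → ℝ) (ℓ : ℝ)
    (Pit w : Fin 3 → Fin 3 → ℝ) : Fin 3 → Fin 3 → ℝ :=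
  fun α β => -ε * yl γ y α * b β + Pit α β + (ℓ / 2) * hcov γ ε y α β + w α β

/-- The pointwise algebraic model of D_μ ξ_ν for ξ = f y: N_{μν} = φ_μ y_ν + f P_{μν}. -/
def N (γ : Fin 3 → Fin 3 → ℝ) (ε : ℝ) (y b φ : Fin 3 → ℝ) (f ℓ : ℝ)
    (Pit w : Fin 3 → Fin 3 → ℝ) : Fin 3 → Fin 3 → ℝ :=
  fun μ ν => φ μ * yl γ y ν + f * P γ ε y b ℓ Pit w μ ν

/-- The inverse of a symmetric metric is symmetric. -/
theorem inv_symm (γ γinv : Fin 3 → Fin 3 → ℝ) (hγs : ∀ α β, γ α β = γ β α)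
    (hγinv2 : ∀ α β, (∑ μ, γ α μ * γinv μ β) = if α = β then (1 : ℝ) else 0) (α β : Fin 3) :
    γinv α β = γinv β α := by
  have hmul : Matrix.of γ * Matrix.of γinv = 1 := by
    ext i j
    simp [Matrix.mul_apply, Matrix.one_apply, hγinv2]
  have hsymm : (Matrix.of γ).transpose = Matrix.of γ := by
    ext i j
    exact hγs j i
  have hmulT : (Matrix.of γinv).transpose * Matrix.of γ = 1 := by
    have h := congrArg Matrix.transpose hmul
    rwa [Matrix.transpose_mul, hsymm, Matrix.transpose_one] at h
  have hT : (Matrix.of γinv).transpose = Matrix.of γinv := left_inv_eq_right_inv hmulT hmul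
  exact congrFun (congrFun hT β) α

/-- Raising the index of the lowered vector gives the vector back. -/
theorem raise_yl (γ γinv : Fin 3 → Fin 3 → ℝ)
    (hγinv1 : ∀ α β, (∑ μ, γinv α μ * γ μ β) = if α = β then (1 : ℝ) else 0)
    (y : Fin 3 → ℝ) (ν : Fin 3) : ∑ ρ, γinv ν ρ * yl γ y ρ = y ν := by
  simp only [yl, Finset.mul_sum, ← mul_assoc]
  rw [Finset.sum_comm]
  simp [← Finset.sum_mul, hγinv1]

/-- Projecting a one-form: `h^ν_{ν'} φ_ν = φ_{ν'} + ε φ(y) y_{ν'}`. -/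
theorem sum_hmix_mul (γ γinv : Fin 3 → Fin 3 → ℝ)
    (hγinv1 : ∀ α β, (∑ μ, γinv α μ * γ μ β) = if α = β then (1 : ℝ) else 0)
    (ε : ℝ) (y φ : Fin 3 → ℝ) (ν' : Fin 3) :
    ∑ ν, hmix γ γinv ε y ν ν' * φ ν = φ ν' + ε * (∑ α, y α * φ α) * yl γ y ν' := by
  have hmix_eq : ∀ ν, hmix γ γinv ε y ν ν' =
      (if ν = ν' then 1 else 0) + ε * y ν * yl γ y ν' := by
    intro ν
    rw [← hγinv1, ← raise_yl γ γinv hγinv1 y ν]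
    simp only [hmix, hcov, Finset.mul_sum, Finset.sum_mul, ← Finset.sum_add_distrib]
    exact Finset.sum_congr rfl fun _ _ => by ring
  simp only [hmix_eq, add_mul, Finset.sum_add_distrib, Finset.mul_sum, Finset.sum_mul]
  congr 1
  · simp
  · exact Finset.sum_congr rfl fun _ _ => by ring

/-- A symmetric and an antisymmetric tensor contract to zero. -/
theorem contract_symm_antisymm (s w : Fin 3 → Fin 3 → ℝ) (hs : ∀ α β, s α β = s β α)
    (hw : ∀ α β, w α β = - w β α) : ∑ α, ∑ β, s α β * w α β = 0 := by
  have h : ∑ α, ∑ β, s α β * w α β = -∑ α, ∑ β, s α β * w α β := by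
    conv_lhs => rw [Finset.sum_comm]
    simp only [← Finset.sum_neg_distrib]
    refine Finset.sum_congr rfl fun α _ => Finset.sum_congr rfl fun β _ => ?_
    rw [hs β α, hw β α, mul_neg]
  linarith

/-- The trace of `N` is `φ(y) + f ℓ`. -/
theorem trace_N (γ γinv : Fin 3 → Fin 3 → ℝ)
    (hγs : ∀ α β, γ α β = γ β α)
    (hγinv1 : ∀ α β, (∑ μ, γinv α μ * γ μ β) = if α = β then (1 : ℝ) else 0)
    (hγinv2 : ∀ α β, (∑ μ, γ α μ * γinv μ β) = if α = β then (1 : ℝ) else 0)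
    (ε : ℝ) (hε : ε * ε = 1)
    (y : Fin 3 → ℝ) (hyy : ∑ α, y α * yl γ y α = -ε) (f ℓ : ℝ)
    (φ b : Fin 3 → ℝ) (Pit w : Fin 3 → Fin 3 → ℝ)
    (hb : (∑ α, b α * y α) = 0)
    (hPy : ∀ β, (∑ α, Pit α β * y α) = 0)
    (hPtr : (∑ α, ∑ β, (γinv α β + ε * y α * y β) * Pit α β) = 0)
    (hw : ∀ α β, w α β = - w β α) :
    ∑ α, ∑ β, γinv α β * N γ ε y b φ f ℓ Pit w α β = (∑ α, y α * φ α) + f * ℓ := by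
  have hsym := inv_symm γ γinv hγs hγinv2
  have contract_right (u : Fin 3 → ℝ) :
      ∑ α, ∑ β, γinv α β * (u α * yl γ y β) = ∑ α, y α * u α := by
    refine Finset.sum_congr rfl fun α _ => ?_
    rw [← raise_yl γ γinv hγinv1 y α, Finset.sum_mul]
    exact Finset.sum_congr rfl fun _ _ => by ring
  have contract_left : ∑ α, ∑ β, γinv α β * (yl γ y α * b β) = 0 := by
    rw [← hb, Finset.sum_comm]
    simp only [mul_comm (b _)]
    rw [← contract_right b]
    refine Finset.sum_congr rfl fun β _ => Finset.sum_congr rfl fun α _ => ?_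
    rw [hsym α β]
    ring
  have trace_metric : ∑ α, ∑ β, γinv α β * γ α β = 3 := by
    have h : ∀ α, ∑ β, γinv α β * γ α β = 1 := fun α => by
      simpa [hγs α] using hγinv1 α α
    simp [h]
  have trace_Pit : ∑ α, ∑ β, γinv α β * Pit α β = 0 := by
    have hyyP : ∑ α, ∑ β, ε * y α * y β * Pit α β = 0 := by
      rw [Finset.sum_comm]
      refine Finset.sum_eq_zero fun β _ => ?_
      rw [← mul_zero (ε * y β), ← hPy β, Finset.mul_sum]
      exact Finset.sum_congr rfl fun _ _ => by ring
    simpa only [add_mul, Finset.sum_add_distrib, hyyP, add_zero] using hPtr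
  have split : ∑ α, ∑ β, γinv α β * N γ ε y b φ f ℓ Pit w α β =
      ∑ α, ∑ β, γinv α β * (φ α * yl γ y β)
        - f * ε * ∑ α, ∑ β, γinv α β * (yl γ y α * b β)
        + f * ∑ α, ∑ β, γinv α β * Pit α β
        + f * (ℓ / 2) * ∑ α, ∑ β, γinv α β * γ α β
        + f * (ℓ / 2) * ε * ∑ α, ∑ β, γinv α β * (yl γ y α * yl γ y β)
        + f * ∑ α, ∑ β, γinv α β * w α β := by
    simp only [N, P, hcov, Finset.mul_sum, ← Finset.sum_add_distrib, ← Finset.sum_sub_distrib]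
    exact Finset.sum_congr rfl fun _ _ => Finset.sum_congr rfl fun _ _ => by ring
  rw [split, contract_right, contract_left, trace_Pit, trace_metric, contract_right, hyy,
    contract_symm_antisymm γinv w hsym hw]
  linear_combination -(f * ℓ / 2) * hε

/-- the conformal Killing equation for ξ = f y in dimension three is
equivalent to the system: h^ν_{ν'} φ_ν = ε f b_{ν'},  y^α φ_α = f ℓ / 2,  Π = 0. -/
theorem stmt19 (γ γinv : Fin 3 → Fin 3 → ℝ)
    (hγs : ∀ α β, γ α β = γ β α)
    (hγinv1 : ∀ α β, (∑ μ, γinv α μ * γ μ β) = if α = β then (1 : ℝ) else 0)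
    (hγinv2 : ∀ α β, (∑ μ, γ α μ * γinv μ β) = if α = β then (1 : ℝ) else 0)
    (ε : ℝ) (hε : ε = 1 ∨ ε = -1)
    (y : Fin 3 → ℝ) (hy : (∑ α, ∑ β, γ α β * y α * y β) = -ε)
    (f : ℝ) (hf : f ≠ 0) (ℓ : ℝ)
    (φ b : Fin 3 → ℝ) (Pit w : Fin 3 → Fin 3 → ℝ)
    (hb : (∑ α, b α * y α) = 0)
    (hPs : ∀ α β, Pit α β = Pit β α)
    (hPy : ∀ β, (∑ α, Pit α β * y α) = 0)
    (hPtr : (∑ α, ∑ β, (γinv α β + ε * y α * y β) * Pit α β) = 0)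
    (hw : ∀ α β, w α β = - w β α)
    (hwy : ∀ β, (∑ α, w α β * y α) = 0) :
    (∀ μ ν,
        (N γ ε y b φ f ℓ Pit w μ ν + N γ ε y b φ f ℓ Pit w ν μ)
          - (2 / 3) * (∑ α, ∑ β, γinv α β * N γ ε y b φ f ℓ Pit w α β) * γ μ ν = 0)
      ↔ ((∀ ν', (∑ ν, hmix γ γinv ε y ν ν' * φ ν) - ε * f * b ν' = 0) ∧
          ((∑ α, y α * φ α) - f * ℓ / 2 = 0) ∧
          (∀ α β, Pit α β = 0)) := by
  have hεε : ε * ε = 1 := by rcases hε with rfl | rfl <;> norm_num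
  have hyy : ∑ α, y α * yl γ y α = -ε := by
    rw [← hy]
    simp only [yl, Finset.mul_sum]
    exact Finset.sum_congr rfl fun _ _ => Finset.sum_congr rfl fun _ _ => by ring
  simp only [trace_N γ γinv hγs hγinv1 hγinv2 ε hεε y hyy f ℓ φ b Pit w hb hPy hPtr hw,
    sum_hmix_mul γ γinv hγinv1]
  set s := ∑ α, y α * φ α with hs
  have expand : ∀ μ ν, N γ ε y b φ f ℓ Pit w μ ν + N γ ε y b φ f ℓ Pit w ν μ
      - 2 / 3 * (s + f * ℓ) * γ μ ν =
      (φ μ - f * ε * b μ) * yl γ y ν + yl γ y μ * (φ ν - f * ε * b ν) + 2 * f * Pit μ ν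
        + f * ℓ * (γ μ ν + ε * yl γ y μ * yl γ y ν) - 2 / 3 * (s + f * ℓ) * γ μ ν := by
    intro μ ν
    simp only [N, P, hcov]
    linear_combination f * hPs ν μ + f * hw μ ν + f * ℓ / 2 * hγs ν μ
  simp only [expand]
  constructor
  · intro h
    have contract : ∀ ν, s * yl γ y ν - ε * (φ ν - f * ε * b ν)
        - 2 / 3 * (s + f * ℓ) * yl γ y ν = 0 := by
      intro ν
      have hν : ∑ μ, y μ * ((φ μ - f * ε * b μ) * yl γ y ν + yl γ y μ * (φ ν - f * ε * b ν)
          + 2 * f * Pit μ ν + f * ℓ * (γ μ ν + ε * yl γ y μ * yl γ y ν)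
          - 2 / 3 * (s + f * ℓ) * γ μ ν) = 0 :=
        Finset.sum_eq_zero fun μ _ => by rw [h μ ν, mul_zero]
      have hγy : ∑ μ, y μ * γ μ ν = yl γ y ν :=
        Finset.sum_congr rfl fun μ _ => by rw [hγs μ ν, mul_comm]
      have hPyν := hPy ν
      simp only [Fin.sum_univ_three] at hν hγy hPyν hb hyy hs
      linear_combination hν + yl γ y ν * hs + f * ε * yl γ y ν * hb
        - (φ ν - f * ε * b ν) * hyy - 2 * f * hPyν - f * ℓ * hγy
        - f * ℓ * ε * yl γ y ν * hyy + f * ℓ * yl γ y ν * hεε + 2 / 3 * (s + f * ℓ) * hγy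
    have hsl : s - f * ℓ / 2 = 0 := by
      have hc : ∑ ν, y ν * (s * yl γ y ν - ε * (φ ν - f * ε * b ν)
          - 2 / 3 * (s + f * ℓ) * yl γ y ν) = 0 :=
        Finset.sum_eq_zero fun ν _ => by rw [contract ν, mul_zero]
      simp only [Fin.sum_univ_three] at hc hb hyy hs
      have hεs : ε * (s - f * ℓ / 2) = 0 := by
        linear_combination -(3 / 4) * hc + 3 / 4 * (s - 2 / 3 * (s + f * ℓ)) * hyy
          + 3 / 4 * ε * hs + 3 / 4 * f * ε * ε * hb
      linear_combination ε * hεs - (s - f * ℓ / 2) * hεε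
    have hφ : ∀ ν, φ ν + ε * s * yl γ y ν - ε * f * b ν = 0 := by
      intro ν
      linear_combination -ε * contract ν - (φ ν - f * ε * b ν) * hεε
        + 4 / 3 * ε * yl γ y ν * hsl
    refine ⟨hφ, hsl, fun μ ν => ?_⟩
    have hfP : f * Pit μ ν = 0 := by
      linear_combination 1 / 2 * h μ ν - 1 / 2 * yl γ y ν * hφ μ - 1 / 2 * yl γ y μ * hφ ν
        + (ε * yl γ y μ * yl γ y ν + 1 / 3 * γ μ ν) * hsl
    exact (mul_eq_zero.mp hfP).resolve_left hf
  · rintro ⟨hφ, hsl, hPit⟩ μ ν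
    linear_combination yl γ y ν * hφ μ + yl γ y μ * hφ ν + 2 * f * hPit μ ν
      - 2 * (ε * yl γ y μ * yl γ y ν + 1 / 3 * γ μ ν) * hsl

end CKV
end
end
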